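/- arXiv:1309.7067 — 8 statements merged into one kernel-verified Lean document; each statement's English description precedes it below -/
import Mathlib

section
/- Let p > q ≥ 1 be integers with gcd(p, q) = 1 and p > 1. Set g = gcd(p + q, p − q), w1 = (p + q)/g, and w2 = (p − q)/g. Then (w1 + w2)/gcd(2, w1 + w2) divides w1 − w2 if and only if p = 2 and q = 1. -/
theorem gcd_add_sub_dvd_two {p q : ℕ} (hpq : q ≤ p) (hcop : Nat.gcd p q = 1) :
    Nat.gcd (p + q) (p - q) ∣ 2 := by
  have hadd := Nat.gcd_dvd_left (p + q) (p - q)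
  have hsub := Nat.gcd_dvd_right (p + q) (p - q)
  have hp : Nat.gcd (p + q) (p - q) ∣ 2 * p := by
    have h := Nat.dvd_add hadd hsub
    rwa [show p + q + (p - q) = 2 * p by omega] at h
  have hq : Nat.gcd (p + q) (p - q) ∣ 2 * q := by
    have h := Nat.dvd_sub hadd hsub
    rwa [show p + q - (p - q) = 2 * q by omega] at h
  simpa [Nat.gcd_mul_left, hcop] using Nat.dvd_gcd hp hq

theorem stmt_5 (p q g w1 w2 : ℕ) (hq : 1 ≤ q) (hpq : q < p) (hp : 1 < p)
    (hcop : Nat.gcd p q = 1)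
    (hg : g = Nat.gcd (p + q) (p - q))
    (hw1 : w1 = (p + q) / g) (hw2 : w2 = (p - q) / g) :
    ((w1 + w2) / Nat.gcd 2 (w1 + w2)) ∣ (w1 - w2) ↔ p = 2 ∧ q = 1 := by
  constructor
  · intro h
    have hg2 : g ∣ 2 := hg ▸ gcd_add_sub_dvd_two hpq.le hcop
    rcases (Nat.dvd_prime Nat.prime_two).1 hg2 with rfl | rfl
    · have hsum : w1 + w2 = 2 * p := by omega
      have hdiff : w1 - w2 = 2 * q := by omega
      rw [hsum, hdiff, Nat.gcd_mul_right_right, Nat.mul_div_cancel_left p two_pos] at h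
      have hle := Nat.le_of_dvd two_pos (Nat.Coprime.dvd_of_dvd_mul_right hcop h)
      omega
    · have heven : 2 ∣ p + q := hg ▸ Nat.gcd_dvd_left (p + q) (p - q)
      have hsum : w1 + w2 = p := by omega
      have hdiff : w1 - w2 = q := by omega
      have hodd : ¬ 2 ∣ p := fun hp2 => by
        have h2 : 2 ∣ Nat.gcd p q := Nat.dvd_gcd hp2 ((Nat.dvd_add_right hp2).1 heven)
        omega
      rw [hsum, hdiff, (Nat.Prime.coprime_iff_not_dvd Nat.prime_two).2 hodd, Nat.div_one] at h
      exact absurd (Nat.le_of_dvd hq h) hpq.not_ge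
  · rintro ⟨rfl, rfl⟩
    subst hg hw1 hw2
    decide
end

section
/- Let w1, w2 and w1', w2' be pairs of positive integers with gcd(w1, w2) = 1 and gcd(w1', w2') = 1, and let r be a positive integer. If w1'·w2'·gcd(w1 + w2, r + 1)² = w1·w2·gcd(w1' + w2', r + 1)², then w1'·w2' = w1·w2 and gcd(w1' + w2', r + 1) = gcd(w1 + w2, r + 1). -/
theorem Nat.Coprime.gcd_add_sq_mul {a b : ℕ} (h : Nat.Coprime a b) (n : ℕ) :
    Nat.Coprime (Nat.gcd (a + b) n ^ 2) (a * b) := by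
  have hsum : Nat.Coprime (a + b) (a * b) :=
    Nat.Coprime.mul_right (by simpa using h.symm) (by simpa using h)
  exact (hsum.coprime_dvd_left (Nat.gcd_dvd_left _ _)).pow_left 2

theorem stmt_6 (w1 w2 w1' w2' r : ℕ)
    (hw1 : 0 < w1) (hw2 : 0 < w2) (hw1' : 0 < w1') (hw2' : 0 < w2') (hr : 0 < r)
    (hcop : Nat.gcd w1 w2 = 1) (hcop' : Nat.gcd w1' w2' = 1)
    (heq : w1' * w2' * (Nat.gcd (w1 + w2) (r + 1)) ^ 2
        = w1 * w2 * (Nat.gcd (w1' + w2') (r + 1)) ^ 2) :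
    w1' * w2' = w1 * w2 ∧
      Nat.gcd (w1' + w2') (r + 1) = Nat.gcd (w1 + w2) (r + 1) := by
  have hdvd : Nat.gcd (w1 + w2) (r + 1) ^ 2 ∣ Nat.gcd (w1' + w2') (r + 1) ^ 2 :=
    (Nat.Coprime.gcd_add_sq_mul hcop (r + 1)).dvd_of_dvd_mul_left (heq ▸ dvd_mul_left _ _)
  have hdvd' : Nat.gcd (w1' + w2') (r + 1) ^ 2 ∣ Nat.gcd (w1 + w2) (r + 1) ^ 2 :=
    (Nat.Coprime.gcd_add_sq_mul hcop' (r + 1)).dvd_of_dvd_mul_left (heq ▸ dvd_mul_left _ _)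
  have hsq := Nat.dvd_antisymm hdvd' hdvd
  refine ⟨?_, Nat.pow_left_injective two_ne_zero hsq⟩
  rw [hsq] at heq
  exact Nat.eq_of_mul_eq_mul_right (pow_pos (Nat.gcd_pos_of_pos_right _ r.succ_pos) 2) heq
end

section
/- Fix an integer d ≥ 1 and a real number t with 0 < t < 1. Define f : ℝ → ℝ by f(c) = ∫_{−1}^{1} ((1 − c) − (1 + c)·z) · ((c + t) + (c − t)·z)^d dz. Then there exists a real number c with t < c such that f(c) = 0. -/
/-- The integral as a function of `c` is continuous. -/
theorem continuous_joinIntegral (d : ℕ) (t : ℝ) :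
    Continuous fun c : ℝ =>
      ∫ z in (-1 : ℝ)..1, ((1 - c) - (1 + c) * z) * ((c + t) + (c - t) * z) ^ d := by
  apply intervalIntegral.continuous_parametric_intervalIntegral_of_continuous'
  fun_prop

/-- At `c = t` the power is constant and the integral is explicit. -/
theorem joinIntegral_self (d : ℕ) (t : ℝ) :
    (∫ z in (-1 : ℝ)..1, ((1 - t) - (1 + t) * z) * ((t + t) + (t - t) * z) ^ d) =
      2 * (1 - t) * (t + t) ^ d := by
  simp only [sub_self, zero_mul, add_zero]
  rw [intervalIntegral.integral_mul_const, intervalIntegral.integral_sub (by simp)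
    (Continuous.intervalIntegrable (by fun_prop) _ _), intervalIntegral.integral_const_mul,
    intervalIntegral.integral_const, integral_id, smul_eq_mul]
  ring

/-- At `c = 1` the integrand is dominated by the odd function `-2 z (1 + t) ^ d`. -/
theorem joinIntegral_one_nonpos (d : ℕ) {t : ℝ} (ht0 : 0 < t) (ht1 : t < 1) :
    (∫ z in (-1 : ℝ)..1, ((1 - 1) - (1 + 1) * z) * ((1 + t) + (1 - t) * z) ^ d) ≤ 0 := by
  calc
    _ ≤ ∫ z in (-1 : ℝ)..1, z * (-2 * (1 + t) ^ d) := by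
      refine intervalIntegral.integral_mono_on (by norm_num)
        (Continuous.intervalIntegrable (by fun_prop) _ _)
        (Continuous.intervalIntegrable (by fun_prop) _ _) fun z hz => ?_
      obtain ⟨hz1, hz2⟩ := hz
      rcases le_total 0 z with h | h
      · have hpow : (1 + t) ^ d ≤ ((1 + t) + (1 - t) * z) ^ d :=
          pow_le_pow_left₀ (by linarith) (by nlinarith) d
        nlinarith [mul_le_mul_of_nonneg_left hpow h]
      · have hpow : ((1 + t) + (1 - t) * z) ^ d ≤ (1 + t) ^ d :=
          pow_le_pow_left₀ (by nlinarith) (by nlinarith) d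
        nlinarith [mul_le_mul_of_nonpos_left hpow h]
    _ = 0 := by
      rw [intervalIntegral.integral_mul_const]
      simp

theorem stmt_8 (d : ℕ) (hd : 1 ≤ d) (t : ℝ) (ht0 : 0 < t) (ht1 : t < 1) :
    ∃ c : ℝ, t < c ∧
      (∫ z in (-1 : ℝ)..1, ((1 - c) - (1 + c) * z) * ((c + t) + (c - t) * z) ^ d) = 0 := by
  have hpos : 0 < 2 * (1 - t) * (t + t) ^ d :=
    mul_pos (by linarith) (pow_pos (by linarith) d)
  obtain ⟨c, hc, hc0⟩ := intermediate_value_Icc' ht1.le (continuous_joinIntegral d t).continuousOn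
    ⟨joinIntegral_one_nonpos d ht0 ht1, (joinIntegral_self d t ▸ hpos).le⟩
  refine ⟨c, lt_of_le_of_ne hc.1 ?_, hc0⟩
  rintro rfl
  exact hpos.ne' ((joinIntegral_self d t).symm.trans hc0)
end

section
/- For every integer d ≥ 1 and every real number k > 1, one has −d + (2 + d)·k − (2 + d)·k^(d+1) + d·k^(d+2) > 0. -/
theorem stmt_11 (d : ℕ) (hd : 1 ≤ d) (k : ℝ) (hk : 1 < k) :
    0 < -(d : ℝ) + (2 + d) * k - (2 + d) * k ^ (d + 1) + d * k ^ (d + 2) := by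
  induction d, hd using Nat.le_induction with
  | base =>
    have h : 0 < (k - 1) ^ 3 := pow_pos (sub_pos.2 hk) 3
    push_cast
    linarith
  | succ d _ ih =>
    have bernoulli : 1 + ((d + 2 : ℕ) : ℝ) * (k - 1) ≤ k ^ (d + 2) := by
      simpa using one_add_mul_le_pow (show (-2 : ℝ) ≤ k - 1 by linarith) (d + 2)
    have h_mul := mul_pos (zero_lt_one.trans hk) ih
    have h_rem := mul_nonneg (sub_nonneg.2 hk.le) (sub_nonneg.2 bernoulli)
    push_cast at h_rem ⊢
    refine (add_pos_of_pos_of_nonneg h_mul h_rem).trans_eq ?_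
    ring
end

section
/- Let k > 1 be a real number and set t = (2 + k)/(k·(1 + 2k)). Then ∫_{−1}^{1} (1 − z)·((k + 1) + (k − 1)·z) dz = k·t·∫_{−1}^{1} (1 + z)·((k + 1) + (k − 1)·z) dz. -/
/-- The integral over `[-1, 1]` of a product of two affine functions. -/
theorem integral_affine_mul_affine (a b c d : ℝ) :
    ∫ z in (-1 : ℝ)..1, (a + b * z) * (c + d * z) = 2 * (a * c) + 2 / 3 * (b * d) := by
  have hderiv (z : ℝ) : HasDerivAt
      (fun z : ℝ => a * c * z + (a * d + b * c) / 2 * z ^ 2 + b * d / 3 * z ^ 3)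
      ((a + b * z) * (c + d * z)) z := by
    refine ((((hasDerivAt_id' z).const_mul (a * c)).add
      ((hasDerivAt_pow 2 z).const_mul ((a * d + b * c) / 2))).add
      ((hasDerivAt_pow 3 z).const_mul (b * d / 3))).congr_deriv ?_
    push_cast
    ring
  rw [intervalIntegral.integral_eq_sub_of_hasDerivAt (fun z _ => hderiv z)
    ((by fun_prop : Continuous fun z : ℝ => (a + b * z) * (c + d * z)).intervalIntegrable _ _)]
  ring

theorem stmt_13 (k : ℝ) (hk : 1 < k) (t : ℝ) (ht : t = (2 + k) / (k * (1 + 2 * k))) :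
    (∫ z in (-1 : ℝ)..1, (1 - z) * ((k + 1) + (k - 1) * z))
      = k * t * ∫ z in (-1 : ℝ)..1, (1 + z) * ((k + 1) + (k - 1) * z) := by
  have hminus := integral_affine_mul_affine 1 (-1) (k + 1) (k - 1)
  have hplus := integral_affine_mul_affine 1 1 (k + 1) (k - 1)
  simp only [neg_one_mul, ← sub_eq_add_neg] at hminus
  simp only [one_mul] at hplus
  have hk₀ : k ≠ 0 := by linarith
  have hk₁ : 1 + 2 * k ≠ 0 := by linarith
  rw [hminus, hplus, ht]
  field_simp
  ring
end

section
/- For every odd prime p with p ≠ 3, neither 27p divides (3p + 1)³ − (p + 3)³ nor 27p divides (3p + 1)³ + (p + 3)³. -/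
theorem stmt_14 (p : ℕ) (hp : p.Prime) (hodd : Odd p) (hp3 : p ≠ 3) :
    ¬ ((27 * (p : ℤ)) ∣ (3 * (p : ℤ) + 1) ^ 3 - ((p : ℤ) + 3) ^ 3) ∧
      ¬ ((27 * (p : ℤ)) ∣ (3 * (p : ℤ) + 1) ^ 3 + ((p : ℤ) + 3) ^ 3) := by
  constructor
  · intro h
    have h26 : (p : ℤ) ∣ 26 := by
      obtain ⟨c, hc⟩ := h
      exact ⟨26 * (p : ℤ) ^ 2 + 18 * p - 18 - 27 * c, by linear_combination -hc⟩
    have hdvd : p ∣ 26 := by exact_mod_cast h26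
    have hle : p ≤ 26 := Nat.le_of_dvd (by norm_num) hdvd
    interval_cases p <;> revert hp hodd hdvd h <;> norm_num
  · intro h
    have h28 : (p : ℤ) ∣ 28 := by
      obtain ⟨c, hc⟩ := h
      exact ⟨27 * c - 28 * (p : ℤ) ^ 2 - 36 * p - 36, by linear_combination hc⟩
    have hdvd : p ∣ 28 := by exact_mod_cast h28
    have hle : p ≤ 28 := Nat.le_of_dvd (by norm_num) hdvd
    interval_cases p <;> revert hp hodd hdvd h <;> norm_num
end

section
/- Let d ≥ 1 be an integer, let r be a real number with 0 < |r| < 1, and let m1, m2 > 0 be real numbers. Define F(z) = ∫_{−1}^{z} ((1 − t)/m2 − (1 + t)/m1)·(1 + r·t)^d dt for z ∈ [−1, 1]. Suppose ∫_{−1}^{1} ((1 − t)/m2 − (1 + t)/m1)·(1 + r·t)^d dt = 0. Then F(−1) = 0, F(1) = 0, F'(−1) = (2/m2)·(1 − r)^d, F'(1) = −(2/m1)·(1 + r)^d, and F(z) > 0 for all z with −1 < z < 1. -/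
theorem stmt_15 (d : ℕ) (hd : 1 ≤ d) (r : ℝ) (hr0 : 0 < |r|) (hr1 : |r| < 1)
    (m1 m2 : ℝ) (hm1 : 0 < m1) (hm2 : 0 < m2)
    (F : ℝ → ℝ)
    (hF : ∀ z : ℝ, F z = ∫ t in (-1 : ℝ)..z, ((1 - t) / m2 - (1 + t) / m1) * (1 + r * t) ^ d)
    (hint : (∫ t in (-1 : ℝ)..1, ((1 - t) / m2 - (1 + t) / m1) * (1 + r * t) ^ d) = 0) :
    F (-1) = 0 ∧ F 1 = 0 ∧
      HasDerivAt F ((2 / m2) * (1 - r) ^ d) (-1) ∧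
      HasDerivAt F (-(2 / m1) * (1 + r) ^ d) 1 ∧
      ∀ z : ℝ, -1 < z → z < 1 → 0 < F z := by
  obtain rfl : F = _ := funext hF
  have hc : Continuous fun t : ℝ => ((1 - t) / m2 - (1 + t) / m1) * (1 + r * t) ^ d := by
    fun_prop
  have hderiv := fun z : ℝ => hc.integral_hasStrictDerivAt (-1) z |>.hasDerivAt
  have hp : ∀ t : ℝ, -1 < t → t < 1 → 0 < (1 + r * t) ^ d := fun t h₁ h₂ => by
    have : |r * t| < 1 := by
      rw [abs_mul]
      exact mul_lt_one_of_nonneg_of_lt_one_left (abs_nonneg r) hr1 (abs_lt.2 ⟨h₁, h₂⟩).le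
    exact pow_pos (by linarith [(abs_lt.1 this).1]) d
  have hanti : ∀ s t : ℝ, s < t →
      (1 - t) / m2 - (1 + t) / m1 < (1 - s) / m2 - (1 + s) / m1 := fun s t h => by
    have h₁ : (1 - t) / m2 < (1 - s) / m2 := by gcongr
    have h₂ : (1 + s) / m1 < (1 + t) / m1 := by gcongr
    linarith
  refine ⟨intervalIntegral.integral_same, hint, ?_, ?_, fun z hz₁ hz₂ => ?_⟩
  · exact (hderiv (-1)).congr_deriv (by ring)
  · exact (hderiv 1).congr_deriv (by ring)
  · rcases le_or_gt 0 ((1 - z) / m2 - (1 + z) / m1) with h | h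
    · exact intervalIntegral.intervalIntegral_pos_of_pos_on (hc.intervalIntegrable _ _)
        (fun t ht => mul_pos (h.trans_lt (hanti t z ht.2)) (hp t ht.1 (ht.2.trans hz₂))) hz₁
    · have hneg := intervalIntegral.intervalIntegral_pos_of_pos_on
        (hc.neg.intervalIntegrable z 1)
        (fun t ht => neg_pos.2 <| mul_neg_of_neg_of_pos ((hanti z t ht.1).trans h)
          (hp t (hz₁.trans ht.1) ht.2)) hz₂
      have hadd := intervalIntegral.integral_add_adjacent_intervals (μ := MeasureTheory.volume)
        (hc.intervalIntegrable (-1) z) (hc.intervalIntegrable z 1)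
      simp only [Pi.neg_apply, intervalIntegral.integral_neg] at hneg
      beta_reduce
      linarith
end

section
/- Let d ≥ 1 be an integer, let r be a real number with 0 < |r| < 1, and let m1, m2 > 0 be real numbers. Then there exists a real number a such that ∫_{−1}^{1} e^{−a·t}·((1 − t)/m2 − (1 + t)/m1)·(1 + r·t)^d dt = 0. -/
/-- For large `a` the exponential weight concentrates on the part of the interval left of `c`. -/
theorem exists_integral_exp_mul_sub_mul_nonneg {u v c : ℝ} (huc : u < c) (hcv : c < v) {q : ℝ → ℝ}
    (hq : Continuous q) (hpos : ∀ t ∈ Set.Icc u v, 0 < q t) :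
    ∃ a : ℝ, 0 ≤ ∫ t in u..v, Real.exp (-(a * (t - c))) * ((c - t) * q t) := by
  have huv : u < v := huc.trans hcv
  have hP : 0 < ∫ t in u..v, max (c - t) 0 * ((c - t) * q t) := by
    refine intervalIntegral.integral_pos huv (by fun_prop) (fun t ht => ?_)
      ⟨u, Set.left_mem_Icc.2 huv.le, ?_⟩
    · have hqt := hpos t (Set.Ioc_subset_Icc_self ht)
      rcases le_total 0 (c - t) with h | h
      · positivity
      · simp [max_eq_right h]
    · have hqu := hpos u (Set.left_mem_Icc.2 huv.le)
      have h : 0 < c - u := sub_pos.2 huc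
      positivity
  set P := ∫ t in u..v, max (c - t) 0 * ((c - t) * q t) with hPdef
  set G := ∫ t in u..v, (c - t) * q t with hGdef
  have ha : 0 ≤ |G| / P := by positivity
  refine ⟨|G| / P, ?_⟩
  calc (0 : ℝ) ≤ G + |G| / P * P := by
        rw [div_mul_cancel₀ _ hP.ne']
        linarith [neg_abs_le G]
    _ = ∫ t in u..v, ((c - t) * q t + |G| / P * (max (c - t) 0 * ((c - t) * q t))) := by
        rw [intervalIntegral.integral_add
          (Continuous.intervalIntegrable (by fun_prop) _ _)
          (Continuous.intervalIntegrable (by fun_prop) _ _),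
          intervalIntegral.integral_const_mul]
    _ ≤ _ := by
        refine intervalIntegral.integral_mono_on huv.le
          (Continuous.intervalIntegrable (by fun_prop) _ _)
          (Continuous.intervalIntegrable (by fun_prop) _ _) fun t ht => ?_
        have hqt := hpos t ht
        generalize |G| / P = a at ha
        rcases le_total 0 (c - t) with h | h
        · have hexp := Real.add_one_le_exp (-(a * (t - c)))
          have hg : 0 ≤ (c - t) * q t := by positivity
          rw [max_eq_left h]
          nlinarith
        · have hexp : Real.exp (-(a * (t - c))) ≤ 1 :=
            Real.exp_le_one_iff.2 (by nlinarith)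
          have hg : (c - t) * q t ≤ 0 := mul_nonpos_of_nonpos_of_nonneg h hqt.le
          rw [max_eq_right h]
          nlinarith

theorem exists_integral_exp_mul_sub_mul_eq_zero {u v c : ℝ} (huc : u < c) (hcv : c < v) {q : ℝ → ℝ}
    (hq : Continuous q) (hpos : ∀ t ∈ Set.Icc u v, 0 < q t) :
    ∃ a : ℝ, ∫ t in u..v, Real.exp (-(a * (t - c))) * ((c - t) * q t) = 0 := by
  obtain ⟨a, ha⟩ := exists_integral_exp_mul_sub_mul_nonneg huc hcv hq hpos
  obtain ⟨b, hb⟩ := exists_integral_exp_mul_sub_mul_nonneg (neg_lt_neg hcv) (neg_lt_neg huc)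
    (q := fun t => q (-t)) (by fun_prop)
    (fun t ht => hpos (-t) ⟨by linarith [ht.2], by linarith [ht.1]⟩)
  have hb' : ∫ t in u..v, Real.exp (-(-b * (t - c))) * ((c - t) * q t) ≤ 0 := by
    rw [← intervalIntegral.integral_comp_neg] at hb
    rw [← neg_nonneg, ← intervalIntegral.integral_neg]
    refine hb.trans_eq (intervalIntegral.integral_congr fun t _ => ?_)
    ring_nf
  have hcont : Continuous fun a : ℝ =>
      ∫ t in u..v, Real.exp (-(a * (t - c))) * ((c - t) * q t) :=
    intervalIntegral.continuous_parametric_intervalIntegral_of_continuous' (by fun_prop) u v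
  exact mem_range_of_exists_le_of_exists_ge hcont ⟨-b, hb'⟩ ⟨a, ha⟩

theorem stmt_16 (d : ℕ) (hd : 1 ≤ d) (r : ℝ) (hr0 : 0 < |r|) (hr1 : |r| < 1)
    (m1 m2 : ℝ) (hm1 : 0 < m1) (hm2 : 0 < m2) :
    ∃ a : ℝ,
      (∫ t in (-1 : ℝ)..1,
        Real.exp (-(a * t)) * ((1 - t) / m2 - (1 + t) / m1) * (1 + r * t) ^ d) = 0 := by
  have hm : 0 < m1 + m2 := by positivity
  obtain ⟨a, ha⟩ := exists_integral_exp_mul_sub_mul_eq_zero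
    (u := -1) (v := 1) (c := (m1 - m2) / (m1 + m2))
    (by rw [lt_div_iff₀ hm]; linarith) (by rw [div_lt_iff₀ hm]; linarith)
    (q := fun t => (1 + r * t) ^ d) (by fun_prop) (fun t ht => by
      have hrt : |r * t| < 1 := by
        rw [abs_mul]
        exact (mul_le_of_le_one_right (abs_nonneg r) (abs_le.2 ht)).trans_lt hr1
      have : 0 < 1 + r * t := by linarith [(abs_lt.1 hrt).1]
      positivity)
  refine ⟨a, ?_⟩
  set c := (m1 - m2) / (m1 + m2) with hc
  have key : ∀ t : ℝ, Real.exp (-(a * t)) * ((1 - t) / m2 - (1 + t) / m1) * (1 + r * t) ^ d =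
      (Real.exp (-(a * c)) * ((m1 + m2) / (m1 * m2))) *
        (Real.exp (-(a * (t - c))) * ((c - t) * (1 + r * t) ^ d)) := fun t => by
    have hexp : Real.exp (-(a * t)) = Real.exp (-(a * c)) * Real.exp (-(a * (t - c))) := by
      rw [← Real.exp_add]
      ring_nf
    have hlin : (1 - t) / m2 - (1 + t) / m1 = (m1 + m2) / (m1 * m2) * (c - t) := by
      rw [hc]
      field_simp
      ring
    rw [hexp, hlin]
    ring
  simp_rw [key]
  rw [intervalIntegral.integral_const_mul, ha, mul_zero]
end
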